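/- arXiv:2508.20590 — 5 statements merged into one kernel-verified Lean document; each statement's English description precedes it below -/
import Mathlib

section
/- Let a, b, c ∈ ℝ³, let τ > 0 and set m := (a + b)/2. If (1/τ)·(b − a) + m × (m × c) = 0, then ‖b‖ = ‖a‖. -/
noncomputable section

/-- Cross product on `ℝ³` with the Euclidean norm. -/
def cross3 (a b : EuclideanSpace ℝ (Fin 3)) : EuclideanSpace ℝ (Fin 3) :=
  (WithLp.equiv 2 (Fin 3 → ℝ)).symm
    (crossProduct ((WithLp.equiv 2 (Fin 3 → ℝ)) a) ((WithLp.equiv 2 (Fin 3 → ℝ)) b))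

theorem inner_cross3_self (v w : EuclideanSpace ℝ (Fin 3)) : inner ℝ v (cross3 v w) = 0 := by
  simp [cross3, PiLp.inner_apply, Fin.sum_univ_three, cross_apply]
  ring

theorem midpoint_double_cross_step_preserves_norm
    (a b c : EuclideanSpace ℝ (Fin 3)) (τ : ℝ) (hτ : 0 < τ)
    (m : EuclideanSpace ℝ (Fin 3)) (hm : m = (2:ℝ)⁻¹ • (a + b))
    (h : (1 / τ) • (b - a) + cross3 m (cross3 m c) = 0) :
    ‖b‖ = ‖a‖ := by
  have hm2 : a + b = (2 : ℝ) • m := by rw [hm, smul_smul]; norm_num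
  have horth : inner ℝ m (b - a) = 0 := by
    have h' := congrArg (inner ℝ m) h
    rw [inner_add_right, inner_cross3_self, inner_smul_right, inner_zero_right, add_zero] at h'
    exact (mul_eq_zero.mp h').resolve_left (one_div_pos.mpr hτ).ne'
  rw [← real_inner_add_sub_eq_zero_iff, add_comm, hm2, inner_smul_left, horth, mul_zero]

end
end

section
/- Let E be a real Banach space, let t ∈ ℝ, τ > 0, and let f : ℝ → E be three times continuously differentiable on [t − 2τ, t] with ‖f'''(s)‖ ≤ M for all s ∈ [t − 2τ, t]. Then the BDF2 consistency error satisfies ‖(1/τ)·((3/2)·f(t) − 2·f(t − τ) + (1/2)·f(t − 2τ)) − f'(t)‖ ≤ M·τ². -/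
/-- **Taylor's theorem** at the right endpoint of an interval, with the sharp polynomial bound on
the remainder. -/
theorem norm_sub_taylorWithinEval_right_le {E : Type*} [NormedAddCommGroup E] [NormedSpace ℝ E]
    {f : ℝ → E} {a b C x : ℝ} {n : ℕ} (hab : a < b)
    (hf : ContDiffOn ℝ (n + 1) f (Set.Icc a b)) (hx : x ∈ Set.Icc a b)
    (hC : ∀ y ∈ Set.Icc a b, ‖iteratedDerivWithin (n + 1) f (Set.Icc a b) y‖ ≤ C) :
    ‖f x - taylorWithinEval f n (Set.Icc a b) b x‖ ≤
      C * (b - x) ^ (n + 1) / (n + 1).factorial := by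
  have hd : DifferentiableOn ℝ (iteratedDerivWithin n f (Set.Icc a b)) (Set.Icc a b) :=
    hf.differentiableOn_iteratedDerivWithin (mod_cast n.lt_succ_self) (uniqueDiffOn_Icc hab)
  have hsub : Set.Icc x b ⊆ Set.Icc a b := Set.Icc_subset_Icc_left hx.1
  have hT : ∀ y ∈ Set.Icc x b, HasDerivWithinAt
      (fun y => taylorWithinEval f n (Set.Icc a b) y x - f x)
      (((n.factorial : ℝ)⁻¹ * (x - y) ^ n) • iteratedDerivWithin (n + 1) f (Set.Icc a b) y)
      (Set.Icc x b) y := fun y hy =>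
    ((hasDerivWithinAt_taylorWithinEval_at_Icc x hab (hsub hy) hf.of_succ hd).mono hsub).sub_const _
  have hB : ∀ y : ℝ, HasDerivAt (fun y => C * (y - x) ^ (n + 1) / (n + 1).factorial)
      (C * (y - x) ^ n / n.factorial) y := fun y => by
    refine (((((hasDerivAt_id y).sub_const x).pow (n + 1)).const_mul C).div_const
      ((n + 1).factorial : ℝ)).congr_deriv ?_
    have := n.factorial_ne_zero
    simp [Nat.factorial_succ]
    field_simp
  rw [norm_sub_rev]
  refine image_norm_le_of_norm_deriv_right_le_deriv_boundary
    (fun y hy => (hT y hy).continuousWithinAt)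
    (fun y hy => (hT y (Set.Ico_subset_Icc_self hy)).mono_of_mem_nhdsWithin
      (Icc_mem_nhdsGE_of_mem hy)) (by simp) hB (fun y hy => ?_) (Set.right_mem_Icc.2 hx.2)
  have hyx : |x - y| = y - x := by rw [abs_sub_comm, abs_of_nonneg (sub_nonneg.2 hy.1)]
  have hnn : 0 ≤ (y - x) ^ n / n.factorial := by
    have := sub_nonneg.2 hy.1
    positivity
  rw [norm_smul, norm_mul, norm_inv, norm_pow, Real.norm_eq_abs (x - y), hyx, Real.norm_natCast]
  calc (n.factorial : ℝ)⁻¹ * (y - x) ^ n * ‖iteratedDerivWithin (n + 1) f (Set.Icc a b) y‖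
      = (y - x) ^ n / n.factorial * ‖iteratedDerivWithin (n + 1) f (Set.Icc a b) y‖ := by ring
    _ ≤ (y - x) ^ n / n.factorial * C :=
      mul_le_mul_of_nonneg_left (hC y (hsub (Set.Ico_subset_Icc_self hy))) hnn
    _ = C * (y - x) ^ n / n.factorial := by ring

theorem bdf2_consistency_error_bound
    {E : Type*} [NormedAddCommGroup E] [NormedSpace ℝ E] [CompleteSpace E]
    (t τ M : ℝ) (hτ : 0 < τ) (f : ℝ → E)
    (hf : ContDiffOn ℝ 3 f (Set.Icc (t - 2 * τ) t))
    (hM : ∀ s ∈ Set.Icc (t - 2 * τ) t,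
      ‖iteratedDerivWithin 3 f (Set.Icc (t - 2 * τ) t) s‖ ≤ M) :
    ‖(1 / τ) • ((3 / 2 : ℝ) • f t - (2:ℝ) • f (t - τ) + (1 / 2 : ℝ) • f (t - 2 * τ)) -
        derivWithin f (Set.Icc (t - 2 * τ) t) t‖ ≤ M * τ ^ 2 := by
  set I := Set.Icc (t - 2 * τ) t
  have key : ∀ x ∈ I, ‖f x - taylorWithinEval f 2 I t x‖ ≤ M * (t - x) ^ 3 / 6 := fun x hx => by
    simpa [Nat.factorial] using
      norm_sub_taylorWithinEval_right_le (n := 2) (by linarith) (by norm_num; exact hf) hx hM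
  have h₁ := key (t - τ) ⟨by linarith, by linarith⟩
  have h₂ := key (t - 2 * τ) ⟨le_rfl, by linarith⟩
  have heq : (1 / τ) • ((3 / 2 : ℝ) • f t - (2:ℝ) • f (t - τ) + (1 / 2 : ℝ) • f (t - 2 * τ)) -
      derivWithin f I t =
      (1 / (2 * τ)) • (f (t - 2 * τ) - taylorWithinEval f 2 I t (t - 2 * τ)) -
        (2 / τ) • (f (t - τ) - taylorWithinEval f 2 I t (t - τ)) := by
    simp only [taylorWithinEval_succ, taylor_within_zero_eval, iteratedDerivWithin_one,
      zero_add]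
    match_scalars <;> simp [Nat.factorial] <;> field_simp <;> ring
  rw [heq]
  calc _ ≤ 1 / (2 * τ) * ‖f (t - 2 * τ) - taylorWithinEval f 2 I t (t - 2 * τ)‖ +
        2 / τ * ‖f (t - τ) - taylorWithinEval f 2 I t (t - τ)‖ := by
        refine (norm_sub_le _ _).trans_eq ?_
        rw [norm_smul, norm_smul, Real.norm_of_nonneg (by positivity),
          Real.norm_of_nonneg (by positivity)]
    _ ≤ 1 / (2 * τ) * (M * (t - (t - 2 * τ)) ^ 3 / 6) +
        2 / τ * (M * (t - (t - τ)) ^ 3 / 6) := by gcongr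
    _ = M * τ ^ 2 := by
      field_simp
      ring
end

section
/- Let u : [0,1] → ℝ be continuously differentiable with u(0) = 0, and let U be the radial ansatz map U(x) = ((x₁/r)·sin(u(r)), (x₂/r)·sin(u(r)), cos(u(r))), r = |x|, defined for 0 < |x| < 1. Then the Dirichlet energy of U over the open unit disk D ⊂ ℝ² equals the one-dimensional energy: (1/2)·∫_D (‖∂₁U(x)‖² + ‖∂₂U(x)‖²) dx = π·∫₀¹ ( r·u'(r)² + sin(u(r))²/r ) dr, both integrals being finite. -/
open MeasureTheory

noncomputable section

/-- Partial derivative of `U` in the `i`-th coordinate direction. -/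
def pderiv2 (i : Fin 2) (U : EuclideanSpace ℝ (Fin 2) → EuclideanSpace ℝ (Fin 3))
    (x : EuclideanSpace ℝ (Fin 2)) : EuclideanSpace ℝ (Fin 3) :=
  fderiv ℝ U x (EuclideanSpace.single i 1)

/-- The radial ansatz map `U(x) = ((x₁/r) sin u(r), (x₂/r) sin u(r), cos u(r))`, `r = |x|`. -/
def ansatz (u : ℝ → ℝ) (x : EuclideanSpace ℝ (Fin 2)) : EuclideanSpace ℝ (Fin 3) :=
  (WithLp.equiv 2 (Fin 3 → ℝ)).symm
    ![x 0 / ‖x‖ * Real.sin (u ‖x‖), x 1 / ‖x‖ * Real.sin (u ‖x‖), Real.cos (u ‖x‖)]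

/-- The open unit disk in `ℝ²`. -/
def unitDisk : Set (EuclideanSpace ℝ (Fin 2)) := {x | ‖x‖ < 1}

theorem hasFDerivAt_norm_of_ne_zero {E : Type*} [NormedAddCommGroup E] [InnerProductSpace ℝ E]
    {x : E} (hx : x ≠ 0) : HasFDerivAt (fun y : E => ‖y‖) (‖x‖⁻¹ • innerSL ℝ x) x := by
  have hx' : ‖x‖ ^ 2 ≠ 0 := pow_ne_zero 2 (norm_ne_zero_iff.2 hx)
  convert! (hasStrictFDerivAt_norm_sq x).hasFDerivAt.sqrt hx' using 1
  · ext y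
    exact (Real.sqrt_sq (norm_nonneg y)).symm
  · ext v
    simp [Real.sqrt_sq (norm_nonneg x)]
    ring

theorem fderiv_ansatz_apply {u : ℝ → ℝ} {u' : ℝ} {x : EuclideanSpace ℝ (Fin 2)} (hx : x ≠ 0)
    (hu : HasDerivAt u u' ‖x‖) (v : EuclideanSpace ℝ (Fin 2)) :
    fderiv ℝ (ansatz u) x v =
      !₂[(v 0 / ‖x‖ - x 0 * inner ℝ x v / ‖x‖ ^ 3) * Real.sin (u ‖x‖)
          + x 0 * inner ℝ x v / ‖x‖ ^ 2 * Real.cos (u ‖x‖) * u',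
        (v 1 / ‖x‖ - x 1 * inner ℝ x v / ‖x‖ ^ 3) * Real.sin (u ‖x‖)
          + x 1 * inner ℝ x v / ‖x‖ ^ 2 * Real.cos (u ‖x‖) * u',
        -(Real.sin (u ‖x‖) * u' * inner ℝ x v / ‖x‖)] := by
  have hr : ‖x‖ ≠ 0 := norm_ne_zero_iff.2 hx
  have hn := hasFDerivAt_norm_of_ne_zero hx
  have hun : HasFDerivAt (fun y : EuclideanSpace ℝ (Fin 2) => u ‖y‖) _ x :=
    hu.comp_hasFDerivAt x hn
  have hcoord (i : Fin 2) : HasFDerivAt (fun y : EuclideanSpace ℝ (Fin 2) => y i)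
      (EuclideanSpace.proj i : EuclideanSpace ℝ (Fin 2) →L[ℝ] ℝ) x :=
    (EuclideanSpace.proj i : EuclideanSpace ℝ (Fin 2) →L[ℝ] ℝ).hasFDerivAt
  have hside (i : Fin 2) :=
    ((hcoord i).fun_mul ((hasDerivAt_inv hr).comp_hasFDerivAt x hn)).fun_mul hun.sin
  have hd : DifferentiableAt ℝ (ansatz u) x := by
    rw [differentiableAt_euclidean]
    intro i
    fin_cases i
    · exact (hside 0).differentiableAt
    · exact (hside 1).differentiableAt
    · exact hun.cos.differentiableAt
  have hcomp (i : Fin 3) : HasFDerivAt (fun y => ansatz u y i)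
      ((EuclideanSpace.proj i : EuclideanSpace ℝ (Fin 3) →L[ℝ] ℝ).comp (fderiv ℝ (ansatz u) x)) x :=
    (EuclideanSpace.proj i : EuclideanSpace ℝ (Fin 3) →L[ℝ] ℝ).hasFDerivAt.comp x hd.hasFDerivAt
  ext i
  fin_cases i
  · have h := DFunLike.congr_fun ((hcomp 0).unique (hside 0)) v
    simp at h ⊢
    rw [h]
    field_simp
    ring
  · have h := DFunLike.congr_fun ((hcomp 1).unique (hside 1)) v
    simp at h ⊢
    rw [h]
    field_simp
    ring
  · have h := DFunLike.congr_fun ((hcomp 2).unique hun.cos) v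
    simp at h ⊢
    rw [h]
    field_simp

theorem ansatz_energy_density {u : ℝ → ℝ} {u' : ℝ} {x : EuclideanSpace ℝ (Fin 2)} (hx : x ≠ 0)
    (hu : HasDerivAt u u' ‖x‖) :
    ‖pderiv2 0 (ansatz u) x‖ ^ 2 + ‖pderiv2 1 (ansatz u) x‖ ^ 2 =
      u' ^ 2 + Real.sin (u ‖x‖) ^ 2 / ‖x‖ ^ 2 := by
  have hr : ‖x‖ ≠ 0 := norm_ne_zero_iff.2 hx
  have hsq : ‖x‖ ^ 2 = x 0 ^ 2 + x 1 ^ 2 := by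
    simp [EuclideanSpace.norm_sq_eq, Fin.sum_univ_two]
  simp only [pderiv2, fderiv_ansatz_apply hx hu, EuclideanSpace.norm_sq_eq (n := Fin 3),
    Fin.sum_univ_three]
  simp [EuclideanSpace.inner_single_right]
  have hsc := Real.sin_sq_add_cos_sq (u ‖x‖)
  generalize Real.sin (u ‖x‖) = s at *
  generalize Real.cos (u ‖x‖) = c at *
  generalize ‖x‖ = r at *
  generalize x 0 = a at *
  generalize x 1 = b at *
  field_simp
  simp only [sq_abs]
  have ha : a ^ 2 = r ^ 2 - b ^ 2 := by linarith
  have hc : c ^ 2 = 1 - s ^ 2 := by linarith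
  grind

theorem integrableOn_reduced_energy {u : ℝ → ℝ} (hu : ContDiffOn ℝ 1 u (Set.Icc 0 1))
    (hu0 : u 0 = 0) :
    IntegrableOn
      (fun r => r * (derivWithin u (Set.Icc 0 1) r) ^ 2 + Real.sin (u r) ^ 2 / r)
      (Set.Ioo 0 1) volume := by
  have hd : ContinuousOn (derivWithin u (Set.Icc 0 1)) (Set.Icc 0 1) :=
    hu.continuousOn_derivWithin (uniqueDiffOn_Icc one_pos) le_rfl
  obtain ⟨C, hC⟩ := isCompact_Icc.exists_bound_of_continuousOn hd
  have hlip : ∀ r ∈ Set.Icc (0 : ℝ) 1, |u r| ≤ C * r := by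
    intro r hr
    have h := (convex_Icc (0 : ℝ) 1).norm_image_sub_le_of_norm_derivWithin_le
      (hu.differentiableOn one_ne_zero) hC (Set.left_mem_Icc.2 zero_le_one) hr
    simpa [hu0, abs_of_nonneg hr.1] using h
  refine Integrable.add ?_ ?_
  · exact ((continuousOn_id.mul (hd.pow 2)).integrableOn_Icc).mono_set Set.Ioo_subset_Icc_self
  · have hcont : ContinuousOn (fun r => Real.sin (u r) ^ 2 / r) (Set.Ioo 0 1) :=
      ((Real.continuous_sin.comp_continuousOn
        (hu.continuousOn.mono Set.Ioo_subset_Icc_self)).pow 2).div continuousOn_id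
          fun r hr => hr.1.ne'
    refine IntegrableOn.of_bound (by simp)
      (hcont.aestronglyMeasurable measurableSet_Ioo) (C ^ 2) ?_
    filter_upwards [ae_restrict_mem measurableSet_Ioo] with r hr
    have hsin : |Real.sin (u r)| ≤ C * r :=
      Real.abs_sin_le_abs.trans (hlip r (Set.Ioo_subset_Icc_self hr))
    have hsq : Real.sin (u r) ^ 2 ≤ (C * r) ^ 2 := sq_le_sq' (abs_le.1 hsin).1 (abs_le.1 hsin).2
    rw [Real.norm_of_nonneg (div_nonneg (sq_nonneg _) hr.1.le), div_le_iff₀ hr.1]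
    nlinarith [mul_nonneg (mul_nonneg (sq_nonneg C) hr.1.le) (sub_nonneg.2 hr.2.le)]

theorem setIntegral_unitDisk_fun_norm (f : ℝ → ℝ) :
    ∫ x in unitDisk, f ‖x‖ = 2 * Real.pi * ∫ r in Set.Ioo (0 : ℝ) 1, r * f r := by
  have hmeas : MeasurableSet unitDisk := measurableSet_lt measurable_norm measurable_const
  have h := integral_fun_norm_addHaar (volume : Measure (EuclideanSpace ℝ (Fin 2)))
    ((Set.Iio 1).indicator f)
  have hball : (volume : Measure (EuclideanSpace ℝ (Fin 2))).real (Metric.ball 0 1) = Real.pi := by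
    simp [Measure.real, EuclideanSpace.volume_ball_fin_two, Real.pi_nonneg]
  have hl : unitDisk.indicator (fun x => f ‖x‖) = fun x => (Set.Iio 1).indicator f ‖x‖ := rfl
  have hr : (fun y : ℝ => y ^ (2 - 1) • (Set.Iio 1).indicator f y) =
      (Set.Iio 1).indicator (fun y => y * f y) := by
    ext y
    by_cases hy : y < 1 <;> simp [hy]
  rw [← integral_indicator hmeas, hl, h, finrank_euclideanSpace_fin, hball, hr,
    setIntegral_indicator measurableSet_Iio, Set.Ioi_inter_Iio]
  simp [mul_assoc]

theorem ansatz_energy_identity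
    (u : ℝ → ℝ) (hu : ContDiffOn ℝ 1 u (Set.Icc 0 1)) (hu0 : u 0 = 0) :
    IntegrableOn
      (fun x => ‖pderiv2 0 (ansatz u) x‖ ^ 2 + ‖pderiv2 1 (ansatz u) x‖ ^ 2)
      unitDisk volume ∧
    IntegrableOn
      (fun r => r * (derivWithin u (Set.Icc 0 1) r) ^ 2 + Real.sin (u r) ^ 2 / r)
      (Set.Ioo 0 1) volume ∧
    (1 / 2) * ∫ x in unitDisk, (‖pderiv2 0 (ansatz u) x‖ ^ 2 + ‖pderiv2 1 (ansatz u) x‖ ^ 2) =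
      Real.pi * ∫ r in Set.Ioo (0:ℝ) 1,
        (r * (derivWithin u (Set.Icc 0 1) r) ^ 2 + Real.sin (u r) ^ 2 / r) := by
  have hred := integrableOn_reduced_energy hu hu0
  have hball : unitDisk = Metric.ball 0 1 := by
    ext x
    simp [unitDisk]
  have hmeas : MeasurableSet unitDisk := hball ▸ measurableSet_ball
  let f : ℝ → ℝ := fun r => derivWithin u (Set.Icc 0 1) r ^ 2 + Real.sin (u r) ^ 2 / r ^ 2
  have hweight : Set.EqOn
      (fun r => r * (derivWithin u (Set.Icc 0 1) r) ^ 2 + Real.sin (u r) ^ 2 / r)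
      (fun r => r * f r) (Set.Ioo 0 1) := by
    intro r hr
    have := hr.1.ne'
    simp only [f]
    field_simp
  have hdensity : (fun x => ‖pderiv2 0 (ansatz u) x‖ ^ 2 + ‖pderiv2 1 (ansatz u) x‖ ^ 2)
      =ᵐ[volume.restrict unitDisk] fun x => f ‖x‖ := by
    filter_upwards [ae_restrict_mem hmeas, ae_restrict_of_ae (Measure.ae_ne volume 0)] with x hx hx0
    have hnhds : Set.Icc (0 : ℝ) 1 ∈ nhds ‖x‖ := Icc_mem_nhds (norm_pos_iff.2 hx0) hx
    exact ansatz_energy_density hx0 (((hu.differentiableOn one_ne_zero) _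
      (mem_of_mem_nhds hnhds)).hasDerivWithinAt.hasDerivAt hnhds)
  refine ⟨?_, hred, ?_⟩
  · refine Integrable.congr ?_ hdensity.symm
    change IntegrableOn (fun x => f ‖x‖) unitDisk volume
    rw [hball, integrableOn_fun_norm_addHaar, finrank_euclideanSpace_fin]
    simpa using hred.congr_fun hweight measurableSet_Ioo
  · rw [integral_congr_ae hdensity, setIntegral_unitDisk_fun_norm,
      setIntegral_congr_fun measurableSet_Ioo hweight]
    ring

end
end

section
/- Let u : (0,1) → ℝ be twice continuously differentiable and let U be the radial ansatz map U(x) = ((x₁/r)·sin(u(r)), (x₂/r)·sin(u(r)), cos(u(r))), r = |x|, for 0 < |x| < 1. Then for every x with r = |x| ∈ (0,1) one has ΔU(x) + (‖∂₁U(x)‖² + ‖∂₂U(x)‖²)·U(x) = ( u''(r) + u'(r)/r − sin(2·u(r))/(2r²) )·e(x), where e(x) := ((x₁/r)·cos(u(r)), (x₂/r)·cos(u(r)), −sin(u(r))). -/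
noncomputable section

/-- Componentwise Laplacian `ΔU = ∂₁₁U + ∂₂₂U`. -/
def lap2 (U : EuclideanSpace ℝ (Fin 2) → EuclideanSpace ℝ (Fin 3))
    (x : EuclideanSpace ℝ (Fin 2)) : EuclideanSpace ℝ (Fin 3) :=
  pderiv2 0 (pderiv2 0 U) x + pderiv2 1 (pderiv2 1 U) x

/-- The unit tangent direction field
`e(x) = ((x₁/r) cos u(r), (x₂/r) cos u(r), −sin u(r))`, `r = |x|`. -/
def ansatzDir (u : ℝ → ℝ) (x : EuclideanSpace ℝ (Fin 2)) : EuclideanSpace ℝ (Fin 3) :=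
  (WithLp.equiv 2 (Fin 3 → ℝ)).symm
    ![x 0 / ‖x‖ * Real.cos (u ‖x‖), x 1 / ‖x‖ * Real.cos (u ‖x‖), -Real.sin (u ‖x‖)]

/-- The equivariant map `x ↦ (x₁ g(r), x₂ g(r), k(r))`, `r = |x|`. -/
def equivariantMap (g k : ℝ → ℝ) (x : EuclideanSpace ℝ (Fin 2)) : EuclideanSpace ℝ (Fin 3) :=
  WithLp.toLp 2 ![x 0 * g ‖x‖, x 1 * g ‖x‖, k ‖x‖]

theorem ansatz_eq_equivariantMap (u : ℝ → ℝ) :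
    ansatz u = equivariantMap (fun r => Real.sin (u r) / r) (fun r => Real.cos (u r)) := by
  funext x
  ext j
  fin_cases j <;> simp [ansatz, equivariantMap] <;> ring

/-- The derivative of a radial function away from the origin. -/
theorem HasDerivAt.hasFDerivAt_comp_norm {E : Type*} [NormedAddCommGroup E]
    [InnerProductSpace ℝ E] {h : ℝ → ℝ} {h' : ℝ} {x : E}
    (hh : HasDerivAt h h' ‖x‖) (hx : 0 < ‖x‖) :
    HasFDerivAt (fun y => h ‖y‖) ((h' / ‖x‖) • innerSL ℝ x) x := by
  have hsq : HasFDerivAt (fun y : E => ‖y‖ ^ 2) (2 • innerSL ℝ x) x :=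
    (hasStrictFDerivAt_norm_sq x).hasFDerivAt
  have hnorm : HasFDerivAt (fun y : E => ‖y‖) ((1 / ‖x‖) • innerSL ℝ x) x := by
    have hsqrt := hsq.sqrt (by positivity)
    simp only [Real.sqrt_sq (norm_nonneg _)] at hsqrt
    refine hsqrt.congr_fderiv ?_
    ext v
    simp
    field_simp
  refine (hh.comp_hasFDerivAt x hnorm).congr_fderiv ?_
  rw [smul_smul, mul_one_div]

theorem hasFDerivAt_coord (j : Fin 2) (x : EuclideanSpace ℝ (Fin 2)) :
    HasFDerivAt (fun y : EuclideanSpace ℝ (Fin 2) => y j)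
      (EuclideanSpace.proj j : EuclideanSpace ℝ (Fin 2) →L[ℝ] ℝ) x :=
  (EuclideanSpace.proj j : EuclideanSpace ℝ (Fin 2) →L[ℝ] ℝ).hasFDerivAt

theorem pderiv2_eq_of_hasFDerivAt {U : EuclideanSpace ℝ (Fin 2) → EuclideanSpace ℝ (Fin 3)}
    {L : Fin 3 → EuclideanSpace ℝ (Fin 2) →L[ℝ] ℝ} {x : EuclideanSpace ℝ (Fin 2)} (i : Fin 2)
    (h : ∀ j, HasFDerivAt (fun y => U y j) (L j) x) :
    pderiv2 i U x = WithLp.toLp 2 fun j => L j (EuclideanSpace.single i 1) := by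
  have hd : DifferentiableAt ℝ U x :=
    differentiableAt_euclidean.2 fun j => (h j).differentiableAt
  ext j
  have hdj := (hasFDerivWithinAt_euclidean (t := Set.univ)).1
    hd.hasFDerivAt.hasFDerivWithinAt j
  have hj := (hdj.hasFDerivAt Filter.univ_mem).unique (h j)
  simpa [pderiv2] using congrArg (fun M => M (EuclideanSpace.single i 1)) hj

theorem pderiv2_equivariantMap {g k : ℝ → ℝ} {g' k' : ℝ} {x : EuclideanSpace ℝ (Fin 2)}
    (hx : 0 < ‖x‖) (hg : HasDerivAt g g' ‖x‖) (hk : HasDerivAt k k' ‖x‖) (i : Fin 2) :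
    pderiv2 i (equivariantMap g k) x = WithLp.toLp 2
      ![(Pi.single i 1 : Fin 2 → ℝ) 0 * g ‖x‖ + x 0 * x i * (g' / ‖x‖),
        (Pi.single i 1 : Fin 2 → ℝ) 1 * g ‖x‖ + x 1 * x i * (g' / ‖x‖), x i * (k' / ‖x‖)] := by
  have hcoord (j : Fin 2) := (hasFDerivAt_coord j x).mul (hg.hasFDerivAt_comp_norm hx)
  rw [pderiv2_eq_of_hasFDerivAt (L := ![_, _, _]) i
    (Fin.forall_fin_succ.2 ⟨hcoord 0, Fin.forall_fin_two.2
      ⟨hcoord 1, hk.hasFDerivAt_comp_norm hx⟩⟩)]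
  ext j
  fin_cases i <;> fin_cases j <;> simp [EuclideanSpace.inner_single_right] <;> ring

theorem pderiv2_pderiv2_equivariantMap {g k g₁ k₁ : ℝ → ℝ} {g₂ k₂ : ℝ}
    {x : EuclideanSpace ℝ (Fin 2)} (hx : 0 < ‖x‖)
    (hg : ∀ᶠ r in nhds ‖x‖, HasDerivAt g (g₁ r) r)
    (hk : ∀ᶠ r in nhds ‖x‖, HasDerivAt k (k₁ r) r)
    (hg₁ : HasDerivAt g₁ g₂ ‖x‖) (hk₁ : HasDerivAt k₁ k₂ ‖x‖) (i : Fin 2) :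
    pderiv2 i (pderiv2 i (equivariantMap g k)) x = WithLp.toLp 2
      ![(2 * (Pi.single i 1 : Fin 2 → ℝ) 0 * x i + x 0) * (g₁ ‖x‖ / ‖x‖) +
          x 0 * x i ^ 2 * ((g₂ - g₁ ‖x‖ / ‖x‖) / ‖x‖ ^ 2),
        (2 * (Pi.single i 1 : Fin 2 → ℝ) 1 * x i + x 1) * (g₁ ‖x‖ / ‖x‖) +
          x 1 * x i ^ 2 * ((g₂ - g₁ ‖x‖ / ‖x‖) / ‖x‖ ^ 2),
        k₁ ‖x‖ / ‖x‖ + x i ^ 2 * ((k₂ - k₁ ‖x‖ / ‖x‖) / ‖x‖ ^ 2)] := by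
  have hcont : Filter.Tendsto (fun y : EuclideanSpace ℝ (Fin 2) => ‖y‖) (nhds x) (nhds ‖x‖) :=
    continuous_norm.tendsto x
  have hev : pderiv2 i (equivariantMap g k) =ᶠ[nhds x] fun y => WithLp.toLp 2
      ![(Pi.single i 1 : Fin 2 → ℝ) 0 * g ‖y‖ + y 0 * y i * (g₁ ‖y‖ / ‖y‖),
        (Pi.single i 1 : Fin 2 → ℝ) 1 * g ‖y‖ + y 1 * y i * (g₁ ‖y‖ / ‖y‖),
        y i * (k₁ ‖y‖ / ‖y‖)] := by
    filter_upwards [hcont.eventually hg, hcont.eventually hk,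
      hcont.eventually (lt_mem_nhds hx)] with y hgy hky hy
    exact pderiv2_equivariantMap hy hgy hky i
  have hquot {h : ℝ → ℝ} {h' : ℝ} (hh : HasDerivAt h h' ‖x‖) :=
    (hh.div (hasDerivAt_id ‖x‖) hx.ne').hasFDerivAt_comp_norm hx
  have hcoord (j : Fin 2) :=
    ((hg.self_of_nhds.hasFDerivAt_comp_norm hx).const_mul ((Pi.single i 1 : Fin 2 → ℝ) j)).add
      (((hasFDerivAt_coord j x).mul (hasFDerivAt_coord i x)).mul (hquot hg₁))
  rw [pderiv2, hev.fderiv_eq, ← pderiv2,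
    pderiv2_eq_of_hasFDerivAt (L := ![_, _, _]) i
    (Fin.forall_fin_succ.2 ⟨hcoord 0, Fin.forall_fin_two.2
      ⟨hcoord 1, (hasFDerivAt_coord i x).mul (hquot hk₁)⟩⟩)]
  ext j
  fin_cases i <;> fin_cases j <;> simp [EuclideanSpace.inner_single_right] <;> field_simp <;> ring

theorem EuclideanSpace.norm_sq_fin_two (x : EuclideanSpace ℝ (Fin 2)) :
    ‖x‖ ^ 2 = x 0 ^ 2 + x 1 ^ 2 := by
  simp [EuclideanSpace.norm_sq_eq]

theorem lap2_equivariantMap {g k g₁ k₁ : ℝ → ℝ} {g₂ k₂ : ℝ}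
    {x : EuclideanSpace ℝ (Fin 2)} (hx : 0 < ‖x‖)
    (hg : ∀ᶠ r in nhds ‖x‖, HasDerivAt g (g₁ r) r)
    (hk : ∀ᶠ r in nhds ‖x‖, HasDerivAt k (k₁ r) r)
    (hg₁ : HasDerivAt g₁ g₂ ‖x‖) (hk₁ : HasDerivAt k₁ k₂ ‖x‖) :
    lap2 (equivariantMap g k) x =
      equivariantMap (fun _ => g₂ + 3 * g₁ ‖x‖ / ‖x‖) (fun _ => k₂ + k₁ ‖x‖ / ‖x‖) x := by
  have hr := EuclideanSpace.norm_sq_fin_two x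
  simp only [lap2, pderiv2_pderiv2_equivariantMap hx hg hk hg₁ hk₁, equivariantMap]
  generalize ‖x‖ = r at *
  ext j
  fin_cases j <;> simp <;> field_simp <;> rw [hr] <;> ring

theorem norm_sq_pderiv2_equivariantMap {g k : ℝ → ℝ} {g' k' : ℝ} {x : EuclideanSpace ℝ (Fin 2)}
    (hx : 0 < ‖x‖) (hg : HasDerivAt g g' ‖x‖) (hk : HasDerivAt k k' ‖x‖) :
    ‖pderiv2 0 (equivariantMap g k) x‖ ^ 2 + ‖pderiv2 1 (equivariantMap g k) x‖ ^ 2 =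
      (g ‖x‖ + ‖x‖ * g') ^ 2 + g ‖x‖ ^ 2 + k' ^ 2 := by
  have hr := EuclideanSpace.norm_sq_fin_two x
  rw [pderiv2_equivariantMap hx hg hk, pderiv2_equivariantMap hx hg hk,
    EuclideanSpace.norm_sq_eq, EuclideanSpace.norm_sq_eq]
  simp [Fin.sum_univ_three]
  generalize ‖x‖ = r at *
  field_simp
  linear_combination (-(r ^ 2 + x 0 ^ 2 + x 1 ^ 2) * g' ^ 2 - 2 * r * g r * g' - k' ^ 2) * hr

theorem ansatz_tension_field
    (u : ℝ → ℝ) (hu : ContDiffOn ℝ 2 u (Set.Ioo 0 1)) :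
    ∀ x : EuclideanSpace ℝ (Fin 2), 0 < ‖x‖ → ‖x‖ < 1 →
      lap2 (ansatz u) x +
          (‖pderiv2 0 (ansatz u) x‖ ^ 2 + ‖pderiv2 1 (ansatz u) x‖ ^ 2) • ansatz u x =
        (deriv (deriv u) ‖x‖ + deriv u ‖x‖ / ‖x‖ -
            Real.sin (2 * u ‖x‖) / (2 * ‖x‖ ^ 2)) • ansatzDir u x := by
  intro x hx hx1
  have hu₁ : ∀ r ∈ Set.Ioo (0 : ℝ) 1, HasDerivAt u (deriv u r) r := fun r hr =>
    ((hu.differentiableOn (by norm_num)).differentiableAt (isOpen_Ioo.mem_nhds hr)).hasDerivAt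
  have hu₂ : HasDerivAt (deriv u) (deriv (deriv u) ‖x‖) ‖x‖ :=
    (((hu.deriv_of_isOpen (m := 1) isOpen_Ioo (by norm_num)).differentiableOn
      one_ne_zero).differentiableAt (isOpen_Ioo.mem_nhds ⟨hx, hx1⟩)).hasDerivAt
  have hg : ∀ r ∈ Set.Ioo (0 : ℝ) 1, HasDerivAt (fun r => Real.sin (u r) / r)
      ((Real.cos (u r) * deriv u r * r - Real.sin (u r)) / r ^ 2) r := fun r hr =>
    ((hu₁ r hr).sin.div (hasDerivAt_id r) hr.1.ne').congr_deriv (by simp)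
  have hk : ∀ r ∈ Set.Ioo (0 : ℝ) 1, HasDerivAt (fun r => Real.cos (u r))
      (-Real.sin (u r) * deriv u r) r := fun r hr => (hu₁ r hr).cos
  have hmem : Set.Ioo (0 : ℝ) 1 ∈ nhds ‖x‖ := isOpen_Ioo.mem_nhds ⟨hx, hx1⟩
  have hu₁x := hu₁ ‖x‖ ⟨hx, hx1⟩
  have hg₁ := (((hu₁x.cos.mul hu₂).mul (hasDerivAt_id ‖x‖)).sub hu₁x.sin).div
    (hasDerivAt_pow 2 ‖x‖) (pow_ne_zero 2 hx.ne')
  have hk₁ := hu₁x.sin.neg.mul hu₂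
  have hlap := lap2_equivariantMap hx (Filter.eventually_of_mem hmem hg)
    (Filter.eventually_of_mem hmem hk) hg₁ hk₁
  have hnorm := norm_sq_pderiv2_equivariantMap hx (hg _ ⟨hx, hx1⟩) (hk _ ⟨hx, hx1⟩)
  rw [ansatz_eq_equivariantMap, hlap, hnorm, Real.sin_two_mul]
  have hsc := Real.sin_sq_add_cos_sq (u ‖x‖)
  simp only [equivariantMap, ansatzDir, Pi.sub_apply, Pi.mul_apply, Pi.neg_apply, id]
  generalize Real.sin (u ‖x‖) = s at *
  generalize Real.cos (u ‖x‖) = c at *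
  generalize deriv (deriv u) ‖x‖ = q at *
  generalize deriv u ‖x‖ = p at *
  generalize ‖x‖ = r at *
  ext j
  fin_cases j <;> simp <;> field_simp
  · linear_combination x 0 * s * (p ^ 2 * r ^ 2 + 1) * hsc
  · linear_combination x 1 * s * (p ^ 2 * r ^ 2 + 1) * hsc
  · linear_combination c * p ^ 2 * r ^ 2 * hsc

end
end

section
/- Let T > 0 and let u : [0,T] × [0,1] → ℝ be twice continuously differentiable with u(t,0) = 0 and ∂ₜu(t,0) = ∂ₜu(t,1) = 0 for all t ∈ [0,T], and suppose u satisfies the radially symmetric harmonic map heat flow equation ∂ₜu(t,r) = ∂ᵣᵣu(t,r) + (1/r)·∂ᵣu(t,r) − sin(2·u(t,r))/(2r²) for all (t,r) ∈ [0,T] × (0,1). Then the energy E(t) := π·∫₀¹ ( r·(∂ᵣu(t,r))² + sin(u(t,r))²/r ) dr is finite for every t, the function t ↦ E(t) is differentiable, and E'(t) = −2π·∫₀¹ r·(∂ₜu(t,r))² dr for all t ∈ [0,T]; in particular E is non-increasing on [0,T]. -/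
open MeasureTheory

/-- Differentiation under the integral sign on a convex set, with derivatives taken within it. -/
theorem hasDerivWithinAt_integral_of_bounded_deriv {α : Type*} [MeasurableSpace α]
    {μ : Measure α} [IsFiniteMeasure μ] {s : Set ℝ} (hs : Convex ℝ s)
    {f f' : ℝ → α → ℝ} {C : ℝ} (hint : ∀ x ∈ s, Integrable (f x) μ)
    (hderiv : ∀ᵐ a ∂μ, ∀ x ∈ s, HasDerivWithinAt (fun y => f y a) (f' x a) s x ∧ |f' x a| ≤ C)
    {x : ℝ} (hx : x ∈ s) :
    HasDerivWithinAt (fun y => ∫ a, f y a ∂μ) (∫ a, f' x a ∂μ) s x := by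
  rw [hasDerivWithinAt_iff_tendsto_slope]
  have hmem : ∀ᶠ y in nhdsWithin x (s \ {x}), y ∈ s \ {x} := self_mem_nhdsWithin
  have hlim : Filter.Tendsto (fun y => ∫ a, slope (fun z => f z a) x y ∂μ)
      (nhdsWithin x (s \ {x})) (nhds (∫ a, f' x a ∂μ)) := by
    refine tendsto_integral_filter_of_dominated_convergence (fun _ => C) ?_ ?_ ?_ ?_
    · filter_upwards [hmem] with y hy
      simp only [slope_def_field]
      exact (((hint y hy.1).sub (hint x hx)).div_const _).aestronglyMeasurable
    · filter_upwards [hmem] with y hy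
      filter_upwards [hderiv] with a ha
      have hle := hs.norm_image_sub_le_of_norm_hasDerivWithin_le
        (fun z hz => (ha z hz).1) (fun z hz => (ha z hz).2) hx hy.1
      have hpos : 0 < ‖y - x‖ := norm_pos_iff.2 (sub_ne_zero.2 hy.2)
      rw [slope_def_field, norm_div, div_le_iff₀ hpos]
      exact hle
    · exact integrable_const C
    · filter_upwards [hderiv] with a ha
      exact hasDerivWithinAt_iff_tendsto_slope.1 (ha x hx).1
  refine hlim.congr' ?_
  filter_upwards [hmem] with y hy
  simp only [slope_def_field]
  rw [integral_div, integral_sub (hint y hy.1) (hint x hx)]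

theorem HasFDerivWithinAt.hasDerivWithinAt_prod_left {E : Type*} [NormedAddCommGroup E]
    [NormedSpace ℝ E] {I J : Set ℝ} {G : ℝ × ℝ → E} {G' : ℝ × ℝ →L[ℝ] E} {t r : ℝ}
    (h : HasFDerivWithinAt G G' (I ×ˢ J) (t, r)) (hr : r ∈ J) :
    HasDerivWithinAt (fun s => G (s, r)) (G' (1, 0)) I t :=
  h.comp_hasDerivWithinAt (f := fun s => (s, r)) t
    ((hasDerivWithinAt_id t I).prodMk (hasDerivWithinAt_const t I r)) fun _ hs => ⟨hs, hr⟩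

theorem HasFDerivWithinAt.hasDerivWithinAt_prod_right {E : Type*} [NormedAddCommGroup E]
    [NormedSpace ℝ E] {I J : Set ℝ} {G : ℝ × ℝ → E} {G' : ℝ × ℝ →L[ℝ] E} {t r : ℝ}
    (h : HasFDerivWithinAt G G' (I ×ˢ J) (t, r)) (ht : t ∈ I) :
    HasDerivWithinAt (fun x => G (t, x)) (G' (0, 1)) J r :=
  h.comp_hasDerivWithinAt (f := fun x => (t, x)) r
    ((hasDerivWithinAt_const r J t).prodMk (hasDerivWithinAt_id r J)) fun _ hx => ⟨ht, hx⟩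

/-- The partial derivatives of a `C²` function on a closed rectangle, with a common bound. -/
theorem ContDiffOn.exists_partial_derivs {a b c d : ℝ} (hab : a < b) (hcd : c < d)
    {u : ℝ → ℝ → ℝ}
    (hu : ContDiffOn ℝ 2 (fun p : ℝ × ℝ => u p.1 p.2) (Set.Icc a b ×ˢ Set.Icc c d)) :
    ∃ (v w vr q : ℝ → ℝ → ℝ) (C : ℝ), 0 ≤ C ∧
      ∀ t ∈ Set.Icc a b, ContinuousOn (vr t) (Set.Icc c d) ∧ ContinuousOn (q t) (Set.Icc c d) ∧
        ∀ r ∈ Set.Icc c d,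
          HasDerivWithinAt (u t) (v t r) (Set.Icc c d) r ∧
          HasDerivWithinAt (fun s => u s r) (w t r) (Set.Icc a b) t ∧
          HasDerivWithinAt (v t) (vr t r) (Set.Icc c d) r ∧
          HasDerivWithinAt (fun s => v s r) (q t r) (Set.Icc a b) t ∧
          HasDerivWithinAt (w t) (q t r) (Set.Icc c d) r ∧
          |v t r| ≤ C ∧ |q t r| ≤ C := by
  set K := Set.Icc a b ×ˢ Set.Icc c d with hK
  set F : ℝ × ℝ → ℝ := fun p => u p.1 p.2
  have hKu : UniqueDiffOn ℝ K := (uniqueDiffOn_Icc hab).prod (uniqueDiffOn_Icc hcd)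
  have hKc : IsCompact K := isCompact_Icc.prod isCompact_Icc
  have hKi : K ⊆ closure (interior K) := by
    rw [hK, interior_prod_eq, interior_Icc, interior_Icc, closure_prod_eq,
      closure_Ioo hab.ne, closure_Ioo hcd.ne]
  set D := fderivWithin ℝ F K
  have hDc : ContDiffOn ℝ 1 D K := hu.fderivWithin hKu (by norm_num)
  set D2 := fderivWithin ℝ D K
  have hD2c : ContinuousOn D2 K := hDc.continuousOn_fderivWithin hKu (by norm_num)
  have hFd : ∀ p ∈ K, HasFDerivWithinAt F (D p) K p := fun p hp =>
    (hu.differentiableOn (by norm_num) p hp).hasFDerivWithinAt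
  have hDd : ∀ p ∈ K, HasFDerivWithinAt D (D2 p) K p := fun p hp =>
    (hDc.differentiableOn (by norm_num) p hp).hasFDerivWithinAt
  have hDe : ∀ e : ℝ × ℝ, ∀ p ∈ K, HasFDerivWithinAt (fun p => D p e) ((D2 p).flip e) K p := by
    intro e p hp
    exact (ContinuousLinearMap.apply ℝ ℝ e).hasFDerivAt.comp_hasFDerivWithinAt p (hDd p hp)
  have hsymm : ∀ p ∈ K, D2 p (1, 0) (0, 1) = D2 p (0, 1) (1, 0) := fun p hp =>
    ((hu p hp).isSymmSndFDerivWithinAt (by simp) hKu (hKi hp) hp) _ _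
  have hcont : ∀ e e' : ℝ × ℝ, ContinuousOn (fun p => D2 p e e') K := fun e e' =>
    (hD2c.clm_apply continuousOn_const).clm_apply continuousOn_const
  obtain ⟨C₁, hC₁⟩ := hKc.exists_bound_of_continuousOn
    (hDc.continuousOn.clm_apply (continuousOn_const (c := ((0 : ℝ), (1 : ℝ)))))
  obtain ⟨C₂, hC₂⟩ := hKc.exists_bound_of_continuousOn (hcont (1, 0) (0, 1))
  have hslice : ∀ t ∈ Set.Icc a b, ∀ G : ℝ × ℝ → ℝ, ContinuousOn G K →
      ContinuousOn (fun r => G (t, r)) (Set.Icc c d) := fun t ht G hG =>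
    hG.comp (by fun_prop) fun r hr => ⟨ht, hr⟩
  refine ⟨fun t r => D (t, r) (0, 1), fun t r => D (t, r) (1, 0),
    fun t r => D2 (t, r) (0, 1) (0, 1), fun t r => D2 (t, r) (1, 0) (0, 1),
    max 0 (max C₁ C₂), le_max_left _ _, fun t ht => ⟨hslice t ht _ (hcont _ _),
    hslice t ht _ (hcont _ _), fun r hr => ?_⟩⟩
  have hp : (t, r) ∈ K := ⟨ht, hr⟩
  refine ⟨(hFd _ hp).hasDerivWithinAt_prod_right ht, (hFd _ hp).hasDerivWithinAt_prod_left hr,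
    (hDe _ _ hp).hasDerivWithinAt_prod_right ht, (hDe _ _ hp).hasDerivWithinAt_prod_left hr, ?_,
    (hC₁ _ hp).trans (by simp), (hC₂ _ hp).trans (by simp)⟩
  exact ((hDe _ _ hp).hasDerivWithinAt_prod_right ht).congr_deriv (hsymm _ hp).symm

theorem abs_le_mul_of_hasDerivWithinAt_of_zero {f f' : ℝ → ℝ} {C : ℝ}
    (hf : ∀ r ∈ Set.Icc (0:ℝ) 1, HasDerivWithinAt f (f' r) (Set.Icc 0 1) r)
    (hb : ∀ r ∈ Set.Icc (0:ℝ) 1, |f' r| ≤ C) (h0 : f 0 = 0) {r : ℝ}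
    (hr : r ∈ Set.Icc (0:ℝ) 1) : |f r| ≤ C * r := by
  have h := (convex_Icc (0:ℝ) 1).norm_image_sub_le_of_norm_hasDerivWithin_le hf hb
    (Set.left_mem_Icc.2 zero_le_one) hr
  simpa [h0, abs_of_nonneg hr.1] using h

/-- Integration by parts against `r dr` when the boundary terms vanish. -/
theorem integral_radial_by_parts_eq_zero {v w v' w' : ℝ → ℝ}
    (hv : ∀ r ∈ Set.Icc (0:ℝ) 1, HasDerivWithinAt v (v' r) (Set.Icc 0 1) r)
    (hw : ∀ r ∈ Set.Icc (0:ℝ) 1, HasDerivWithinAt w (w' r) (Set.Icc 0 1) r)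
    (hv' : ContinuousOn v' (Set.Icc 0 1)) (hw' : ContinuousOn w' (Set.Icc 0 1))
    (hw1 : w 1 = 0) :
    IntegrableOn (fun r => (v r + r * v' r) * w r + r * v r * w' r) (Set.Ioo 0 1) volume ∧
    ∫ r in Set.Ioo (0:ℝ) 1, ((v r + r * v' r) * w r + r * v r * w' r) = 0 := by
  have hvc : ContinuousOn v (Set.Icc 0 1) := fun r hr => (hv r hr).continuousWithinAt
  have hwc : ContinuousOn w (Set.Icc 0 1) := fun r hr => (hw r hr).continuousWithinAt
  have hc : ContinuousOn (fun r => (v r + r * v' r) * w r + r * v r * w' r) (Set.Icc 0 1) := by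
    fun_prop
  have hi := hc.integrableOn_Icc (μ := volume)
  refine ⟨hi.mono_set Set.Ioo_subset_Icc_self, ?_⟩
  rw [← integral_Ioc_eq_integral_Ioo, ← intervalIntegral.integral_of_le zero_le_one,
    intervalIntegral.integral_eq_sub_of_hasDerivAt_of_le (f := fun r => r * v r * w r)
      zero_le_one (by fun_prop) ?_ ?_]
  · simp [hw1]
  · intro r hr
    have hn := Icc_mem_nhds hr.1 hr.2
    have hrI := Set.Ioo_subset_Icc_self hr
    have h := ((hasDerivAt_id r).mul ((hv r hrI).hasDerivAt hn)).mul ((hw r hrI).hasDerivAt hn)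
    refine h.congr_deriv ?_
    simp only [Pi.mul_apply, id_eq, one_mul]
  · exact (intervalIntegrable_iff_integrableOn_Icc_of_le zero_le_one).2 hi

theorem rshmhf_energy_dissipation
    (T : ℝ) (hT : 0 < T) (u : ℝ → ℝ → ℝ)
    (hu : ContDiffOn ℝ 2 (fun p : ℝ × ℝ => u p.1 p.2) (Set.Icc 0 T ×ˢ Set.Icc 0 1))
    (hbc : ∀ t ∈ Set.Icc (0:ℝ) T, u t 0 = 0)
    (hbt0 : ∀ t ∈ Set.Icc (0:ℝ) T, derivWithin (fun s => u s 0) (Set.Icc 0 T) t = 0)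
    (hbt1 : ∀ t ∈ Set.Icc (0:ℝ) T, derivWithin (fun s => u s 1) (Set.Icc 0 T) t = 0)
    (hpde : ∀ t ∈ Set.Icc (0:ℝ) T, ∀ r ∈ Set.Ioo (0:ℝ) 1,
      derivWithin (fun s => u s r) (Set.Icc 0 T) t =
        deriv (deriv (u t)) r + (1 / r) * deriv (u t) r -
          Real.sin (2 * u t r) / (2 * r ^ 2)) :
    (∀ t ∈ Set.Icc (0:ℝ) T,
        IntegrableOn (fun r => r * (deriv (u t) r) ^ 2 + Real.sin (u t r) ^ 2 / r)
          (Set.Ioo 0 1) volume) ∧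
    (∀ t ∈ Set.Icc (0:ℝ) T,
        HasDerivWithinAt
          (fun σ => Real.pi * ∫ r in Set.Ioo (0:ℝ) 1,
              (r * (deriv (u σ) r) ^ 2 + Real.sin (u σ r) ^ 2 / r))
          (-2 * Real.pi * ∫ r in Set.Ioo (0:ℝ) 1,
              r * (derivWithin (fun s => u s r) (Set.Icc 0 T) t) ^ 2)
          (Set.Icc 0 T) t) ∧
    (∀ s ∈ Set.Icc (0:ℝ) T, ∀ t ∈ Set.Icc (0:ℝ) T, s ≤ t →
        Real.pi * ∫ r in Set.Ioo (0:ℝ) 1,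
            (r * (deriv (u t) r) ^ 2 + Real.sin (u t r) ^ 2 / r) ≤
          Real.pi * ∫ r in Set.Ioo (0:ℝ) 1,
            (r * (deriv (u s) r) ^ 2 + Real.sin (u s r) ^ 2 / r)) := by
  obtain ⟨v, w, vr, q, C, hC, h⟩ := hu.exists_partial_derivs hT zero_lt_one
  have hsub : Set.Ioo (0:ℝ) 1 ⊆ Set.Icc 0 1 := Set.Ioo_subset_Icc_self
  have hut : ∀ t ∈ Set.Icc (0:ℝ) T, ∀ r ∈ Set.Icc (0:ℝ) 1,
      derivWithin (fun s => u s r) (Set.Icc 0 T) t = w t r := fun t ht r hr =>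
    ((h t ht).2.2 r hr).2.1.derivWithin (uniqueDiffOn_Icc hT t ht)
  have hur : ∀ t ∈ Set.Icc (0:ℝ) T, ∀ r ∈ Set.Ioo (0:ℝ) 1, deriv (u t) r = v t r :=
    fun t ht r hr =>
      (((h t ht).2.2 r (hsub hr)).1.hasDerivAt (Icc_mem_nhds hr.1 hr.2)).deriv
  have hurr : ∀ t ∈ Set.Icc (0:ℝ) T, ∀ r ∈ Set.Ioo (0:ℝ) 1, deriv (deriv (u t)) r = vr t r := by
    intro t ht r hr
    have heq : deriv (u t) =ᶠ[nhds r] v t := by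
      filter_upwards [Ioo_mem_nhds hr.1 hr.2] with x hx using hur t ht x hx
    rw [heq.deriv_eq]
    exact (((h t ht).2.2 r (hsub hr)).2.2.1.hasDerivAt (Icc_mem_nhds hr.1 hr.2)).deriv
  have hub : ∀ t ∈ Set.Icc (0:ℝ) T, ∀ r ∈ Set.Icc (0:ℝ) 1, |u t r| ≤ C * r := fun t ht r hr =>
    abs_le_mul_of_hasDerivWithinAt_of_zero (fun x hx => ((h t ht).2.2 x hx).1)
      (fun x hx => ((h t ht).2.2 x hx).2.2.2.2.2.1) (hbc t ht) hr
  have hwb : ∀ t ∈ Set.Icc (0:ℝ) T, ∀ r ∈ Set.Icc (0:ℝ) 1, |w t r| ≤ C * r := fun t ht r hr =>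
    abs_le_mul_of_hasDerivWithinAt_of_zero (fun x hx => ((h t ht).2.2 x hx).2.2.2.2.1)
      (fun x hx => ((h t ht).2.2 x hx).2.2.2.2.2.2)
      ((hut t ht 0 (by simp)).symm.trans (hbt0 t ht)) hr
  have hsin : ∀ t ∈ Set.Icc (0:ℝ) T, ∀ r ∈ Set.Icc (0:ℝ) 1, |Real.sin (u t r)| ≤ C * r :=
    fun t ht r hr => (Real.abs_sin_le_abs).trans (hub t ht r hr)
  have huc : ∀ t ∈ Set.Icc (0:ℝ) T, ContinuousOn (u t) (Set.Ioo 0 1) := fun t ht r hr =>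
    ((h t ht).2.2 r (hsub hr)).1.continuousWithinAt.mono hsub
  have hvc : ∀ t ∈ Set.Icc (0:ℝ) T, ContinuousOn (v t) (Set.Ioo 0 1) := fun t ht r hr =>
    ((h t ht).2.2 r (hsub hr)).2.2.1.continuousWithinAt.mono hsub
  have hwc : ∀ t ∈ Set.Icc (0:ℝ) T, ContinuousOn (w t) (Set.Icc 0 1) := fun t ht r hr =>
    ((h t ht).2.2 r hr).2.2.2.2.1.continuousWithinAt
  have hdens : ∀ t ∈ Set.Icc (0:ℝ) T, Set.EqOn
      (fun r => r * (deriv (u t) r) ^ 2 + Real.sin (u t r) ^ 2 / r)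
      (fun r => r * (v t r) ^ 2 + Real.sin (u t r) ^ 2 / r) (Set.Ioo 0 1) := by
    intro t ht r hr
    simp only [hur t ht r hr]
  have hint : ∀ t ∈ Set.Icc (0:ℝ) T, IntegrableOn
      (fun r => r * (v t r) ^ 2 + Real.sin (u t r) ^ 2 / r) (Set.Ioo 0 1) volume := by
    intro t ht
    have hu' := huc t ht
    have hv' := hvc t ht
    have hcont : ContinuousOn (fun r => r * (v t r) ^ 2 + Real.sin (u t r) ^ 2 / r)
        (Set.Ioo 0 1) :=
      (continuousOn_id.mul (hv'.pow 2)).add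
        (((Real.continuous_sin.comp_continuousOn hu').pow 2).div continuousOn_id
          fun r hr => hr.1.ne')
    refine IntegrableOn.of_bound measure_Ioo_lt_top
      (hcont.aestronglyMeasurable measurableSet_Ioo) (C ^ 2 + C ^ 2) ?_
    filter_upwards [ae_restrict_mem measurableSet_Ioo] with r hr
    have hv2 : v t r ^ 2 ≤ C ^ 2 := sq_le_sq' (abs_le.1 ((h t ht).2.2 r (hsub hr)).2.2.2.2.2.1).1
      (abs_le.1 ((h t ht).2.2 r (hsub hr)).2.2.2.2.2.1).2
    have hs2 : Real.sin (u t r) ^ 2 ≤ (C * r) ^ 2 :=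
      sq_le_sq' (abs_le.1 (hsin t ht r (hsub hr))).1 (abs_le.1 (hsin t ht r (hsub hr))).2
    have hr0 := hr.1
    rw [Real.norm_of_nonneg (by positivity)]
    refine add_le_add ?_ ?_
    · exact (mul_le_of_le_one_left (sq_nonneg _) hr.2.le).trans hv2
    · rw [div_le_iff₀ hr0]
      nlinarith [mul_nonneg (mul_nonneg (sq_nonneg C) hr0.le) (sub_nonneg.2 hr.2.le)]
  have hdt : ∀ t ∈ Set.Icc (0:ℝ) T, ∀ r ∈ Set.Ioo (0:ℝ) 1,
      HasDerivWithinAt (fun σ => r * (v σ r) ^ 2 + Real.sin (u σ r) ^ 2 / r)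
        (r * (2 * v t r * q t r) + 2 * Real.sin (u t r) * Real.cos (u t r) * w t r / r)
        (Set.Icc 0 T) t ∧
      |r * (2 * v t r * q t r) + 2 * Real.sin (u t r) * Real.cos (u t r) * w t r / r|
        ≤ 4 * C ^ 2 := by
    intro t ht r hr
    obtain ⟨-, hd, -, hq, -, hvC, hqC⟩ := (h t ht).2.2 r (hsub hr)
    have hr0 := hr.1
    refine ⟨?_, ?_⟩
    · refine (((hq.pow 2).const_mul r).add ((hd.sin.pow 2).div_const r)).congr_deriv ?_
      norm_num
      ring
    · have h1 : |r * (2 * v t r * q t r)| ≤ 2 * C ^ 2 := by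
        rw [abs_mul, abs_mul, abs_mul, abs_of_pos hr0, abs_two]
        calc r * (2 * |v t r| * |q t r|) ≤ 1 * (2 * C * C) := by gcongr; exact hr.2.le
          _ = 2 * C ^ 2 := by ring
      have h2 : |2 * Real.sin (u t r) * Real.cos (u t r) * w t r / r| ≤ 2 * C ^ 2 := by
        rw [abs_div, abs_mul, abs_mul, abs_mul, abs_of_pos hr0, abs_two, div_le_iff₀ hr0]
        calc 2 * |Real.sin (u t r)| * |Real.cos (u t r)| * |w t r|
            ≤ 2 * (C * r) * 1 * (C * 1) := by
              gcongr
              · exact hsin t ht r (hsub hr)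
              · exact Real.abs_cos_le_one _
              · exact (hwb t ht r (hsub hr)).trans (by gcongr; exact hr.2.le)
          _ = 2 * C ^ 2 * r := by ring
      exact (abs_add_le _ _).trans (by linarith)
  have hval : ∀ t ∈ Set.Icc (0:ℝ) T, ∫ r in Set.Ioo (0:ℝ) 1,
      (r * (2 * v t r * q t r) + 2 * Real.sin (u t r) * Real.cos (u t r) * w t r / r) =
      -2 * ∫ r in Set.Ioo (0:ℝ) 1,
        r * (derivWithin (fun s => u s r) (Set.Icc 0 T) t) ^ 2 := by
    intro t ht
    obtain ⟨hi, h0⟩ := integral_radial_by_parts_eq_zero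
      (fun r hr => ((h t ht).2.2 r hr).2.2.1) (fun r hr => ((h t ht).2.2 r hr).2.2.2.2.1)
      (h t ht).1 (h t ht).2.1 ((hut t ht 1 (by simp)).symm.trans (hbt1 t ht))
    have hw' := hwc t ht
    have hwi : IntegrableOn (fun r => r * w t r ^ 2) (Set.Ioo 0 1) volume :=
      (ContinuousOn.integrableOn_Icc (by fun_prop)).mono_set hsub
    have e1 : ∫ r in Set.Ioo (0:ℝ) 1, r * (derivWithin (fun s => u s r) (Set.Icc 0 T) t) ^ 2 =
        ∫ r in Set.Ioo (0:ℝ) 1, r * w t r ^ 2 :=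
      setIntegral_congr_fun measurableSet_Ioo fun r hr => by simp only [hut t ht r (hsub hr)]
    have e2 : ∫ r in Set.Ioo (0:ℝ) 1,
        (r * (2 * v t r * q t r) + 2 * Real.sin (u t r) * Real.cos (u t r) * w t r / r) =
        ∫ r in Set.Ioo (0:ℝ) 1, (2 * ((v t r + r * vr t r) * w t r + r * v t r * q t r) -
          2 * (r * w t r ^ 2)) := by
      refine setIntegral_congr_fun measurableSet_Ioo fun r hr => ?_
      have hp := hpde t ht r hr
      rw [hut t ht r (hsub hr), hurr t ht r hr, hur t ht r hr, Real.sin_two_mul] at hp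
      have hr0 := hr.1.ne'
      have hp' : r * w t r = r * vr t r + v t r - Real.sin (u t r) * Real.cos (u t r) / r := by
        rw [hp]; field_simp
      linear_combination (2 * w t r) * hp'
    rw [e1, e2, integral_sub (hi.const_mul 2) (hwi.const_mul 2), integral_const_mul,
      integral_const_mul, h0]
    ring
  have hE : ∀ t ∈ Set.Icc (0:ℝ) T, HasDerivWithinAt
      (fun σ => Real.pi * ∫ r in Set.Ioo (0:ℝ) 1,
          (r * (deriv (u σ) r) ^ 2 + Real.sin (u σ r) ^ 2 / r))
      (-2 * Real.pi * ∫ r in Set.Ioo (0:ℝ) 1,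
          r * (derivWithin (fun s => u s r) (Set.Icc 0 T) t) ^ 2)
      (Set.Icc 0 T) t := by
    intro t ht
    have hd := hasDerivWithinAt_integral_of_bounded_deriv (convex_Icc (0:ℝ) T) hint
      ((ae_restrict_mem measurableSet_Ioo).mono fun r hr t ht => hdt t ht r hr) ht
    rw [hval t ht] at hd
    refine ((hd.const_mul Real.pi).congr_deriv (by ring)).congr (fun σ hσ => ?_) ?_
    · rw [setIntegral_congr_fun measurableSet_Ioo (hdens σ hσ)]
    · rw [setIntegral_congr_fun measurableSet_Ioo (hdens t ht)]
  refine ⟨fun t ht => (integrableOn_congr_fun (hdens t ht) measurableSet_Ioo).2 (hint t ht),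
    hE, ?_⟩
  refine antitoneOn_of_hasDerivWithinAt_nonpos (convex_Icc (0:ℝ) T)
    (fun t ht => (hE t ht).continuousWithinAt)
    (fun t ht => (hE t (interior_subset ht)).mono interior_subset) fun t ht => ?_
  have hnn : 0 ≤ ∫ r in Set.Ioo (0:ℝ) 1,
      r * (derivWithin (fun s => u s r) (Set.Icc 0 T) t) ^ 2 :=
    setIntegral_nonneg measurableSet_Ioo fun r hr => mul_nonneg hr.1.le (sq_nonneg _)
  nlinarith [mul_nonneg Real.pi_pos.le hnn]
end
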